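/- Let E₁ and E₂ be finite Galois extensions of a field F, linearly disjoint over F, with Galois groups G₁ and G₂. Let H₁ ≤ G₁ and H₂ ≤ G₂ with fixed fields K₁ and K₂ respectively. Then Aut(K₁K₂/F) ≅ Aut(K₁/F) × Aut(K₂/F). -/

import Mathlib

open scoped TensorProduct in
theorem aux_tensor {F Ω : Type*} [Field F] [Field Ω] [Algebra F Ω] [FiniteDimensional F Ω]
    (L1 L2 : IntermediateField F Ω) (h : L1.LinearDisjoint L2) :
    ∃ e : (L1 ⊗[F] L2) ≃ₐ[F] ↥(L1 ⊔ L2), ∀ a b, ((e (a ⊗ₜ b) : ↥(L1 ⊔ L2)) : Ω) = a * b := by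
  rw [IntermediateField.linearDisjoint_iff'] at h
  have hs := IntermediateField.sup_toSubalgebra_of_left L1 L2
  let e : (L1 ⊗[F] L2) ≃ₐ[F] ↥(L1 ⊔ L2) :=
    (Subalgebra.LinearDisjoint.mulMap h).trans (Subalgebra.equivOfEq _ _ hs.symm)
  exact ⟨e, fun a b => rfl⟩

theorem aux_inf {F Ω : Type*} [Field F] [Field Ω] [Algebra F Ω] [FiniteDimensional F Ω]
    (E1 L1 L2 : IntermediateField F Ω) (h : E1.LinearDisjoint L2) (hle : L1 ≤ E1) :
    (L1 ⊔ L2) ⊓ E1 = L1 := by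
  set M := (L1 ⊔ L2) ⊓ E1 with hM
  have h1 : L1 ≤ M := le_inf le_sup_left hle
  have hs : M ⊔ L2 = L1 ⊔ L2 :=
    le_antisymm (sup_le inf_le_left le_sup_right) (sup_le_sup_right h1 _)
  have hd1 : L1.LinearDisjoint L2 := h.of_le_left hle
  have hd2 : M.LinearDisjoint L2 := h.of_le_left inf_le_right
  have e1 := hd1.finrank_sup
  have e2 := hd2.finrank_sup
  rw [hs, e1] at e2
  have := Nat.eq_of_mul_eq_mul_right Module.finrank_pos e2
  exact (IntermediateField.eq_of_le_of_finrank_eq h1 this).symm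

theorem aux_mem {F Ω : Type*} [Field F] [Field Ω] [Algebra F Ω] [FiniteDimensional F Ω]
    [IsGalois F Ω] (E1 L1 K : IntermediateField F Ω) [IsGalois F E1] (hi : K ⊓ E1 = L1)
    (σ : K ≃ₐ[F] K) (x : K) (hx : (x : Ω) ∈ L1) : (σ x : Ω) ∈ L1 := by
  rw [← hi] at hx ⊢
  refine ⟨(σ x).2, ?_⟩
  let τ : Ω ≃ₐ[F] Ω := σ.liftNormal Ω
  have h1 : τ x = σ x := σ.liftNormal_commutes Ω x
  have h2 := (IntermediateField.normal_iff_forall_map_le'.1 (inferInstance : Normal F E1)) τ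
  rw [← h1]
  exact h2 ⟨x, hx.2, rfl⟩

theorem aux_restrict {F Ω : Type*} [Field F] [Field Ω] [Algebra F Ω]
    (L K : IntermediateField F Ω) (hL : L ≤ K)
    (h : ∀ (σ : K ≃ₐ[F] K) (x : K), (x : Ω) ∈ L → (σ x : Ω) ∈ L) (σ : K ≃ₐ[F] K) :
    ∃ s : L ≃ₐ[F] L, ∀ x : L, (s x : Ω) = σ ⟨x, hL x.2⟩ := by
  refine ⟨{ toFun := fun x => ⟨σ ⟨x, hL x.2⟩, h σ _ x.2⟩
            invFun := fun x => ⟨σ.symm ⟨x, hL x.2⟩, h σ.symm _ x.2⟩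
            left_inv := fun x => by simp
            right_inv := fun x => by simp
            map_mul' := fun x y => Subtype.ext ?_
            map_add' := fun x y => Subtype.ext ?_
            commutes' := fun r => Subtype.ext ?_ }, fun x => rfl⟩
  · exact congrArg (fun z : K => (z : Ω)) (map_mul σ ⟨x, hL x.2⟩ ⟨y, hL y.2⟩)
  · exact congrArg (fun z : K => (z : Ω)) (map_add σ ⟨x, hL x.2⟩ ⟨y, hL y.2⟩)
  · exact congrArg (fun z : K => (z : Ω)) (σ.commutes r)

open scoped TensorProduct in
theorem aux_main {F Ω : Type*} [Field F] [Field Ω] [Algebra F Ω] [FiniteDimensional F Ω]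
    [IsGalois F Ω] (E1 E2 L1 L2 : IntermediateField F Ω) [IsGalois F E1] [IsGalois F E2]
    (hdisj : E1 ⊓ E2 = ⊥) (h1 : L1 ≤ E1) (h2 : L2 ≤ E2) :
    Nonempty ((L1 ≃ₐ[F] L1) × (L2 ≃ₐ[F] L2) ≃* (↥(L1 ⊔ L2) ≃ₐ[F] ↥(L1 ⊔ L2))) := by
  have hE : E1.LinearDisjoint E2 := IntermediateField.LinearDisjoint.of_inf_eq_bot hdisj
  obtain ⟨e, he⟩ := aux_tensor L1 L2 (hE.of_le h1 h2)
  have i1 := aux_inf E1 L1 L2 (hE.of_le_right h2) h1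
  have i2 := aux_inf E2 L2 L1 (hE.symm.of_le_right h1) h2
  rw [sup_comm] at i2
  have m1 := aux_mem E1 L1 _ i1
  have m2 := aux_mem E2 L2 _ i2
  let f : (L1 ≃ₐ[F] L1) × (L2 ≃ₐ[F] L2) →* ((L1 ⊗[F] L2) ≃ₐ[F] (L1 ⊗[F] L2)) :=
    { toFun := fun p => Algebra.TensorProduct.congr p.1 p.2
      map_one' := Algebra.TensorProduct.congr_refl
      map_mul' := fun p q => Algebra.TensorProduct.congr_trans q.1 p.1 q.2 p.2 }
  let Φ : (L1 ≃ₐ[F] L1) × (L2 ≃ₐ[F] L2) →* (↥(L1 ⊔ L2) ≃ₐ[F] ↥(L1 ⊔ L2)) :=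
    (AlgEquiv.autCongr e).toMonoidHom.comp f
  have hΦ : ∀ p a b, ((Φ p (e (a ⊗ₜ b)) : ↥(L1 ⊔ L2)) : Ω) = p.1 a * p.2 b := by
    intro p a b
    have : Φ p (e (a ⊗ₜ b)) = e (p.1 a ⊗ₜ p.2 b) := by
      change e (Algebra.TensorProduct.congr p.1 p.2 (e.symm (e (a ⊗ₜ b)))) = _
      rw [AlgEquiv.symm_apply_apply]
      rfl
    rw [this, he]
  refine ⟨MulEquiv.ofBijective Φ ⟨?_, ?_⟩⟩
  · intro p q hpq
    refine Prod.ext (AlgEquiv.ext fun a => Subtype.ext ?_) (AlgEquiv.ext fun b => Subtype.ext ?_)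
    · have := hΦ p a 1
      rw [hpq, hΦ] at this
      simpa using this.symm
    · have := hΦ p 1 b
      rw [hpq, hΦ] at this
      simpa using this.symm
  · intro σ
    obtain ⟨s, hs⟩ := aux_restrict L1 _ le_sup_left m1 σ
    obtain ⟨t, ht⟩ := aux_restrict L2 _ le_sup_right m2 σ
    refine ⟨(s, t), AlgEquiv.ext fun x => ?_⟩
    obtain ⟨z, rfl⟩ := e.surjective x
    induction z with
    | zero => simp
    | add x y hx hy => simp only [map_add, hx, hy]
    | tmul a b =>
      apply Subtype.ext
      rw [hΦ]
      have : e (a ⊗ₜ b) = (⟨a, le_sup_left (a := L1) a.2⟩ : ↥(L1 ⊔ L2)) *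
          ⟨b, le_sup_right (a := L1) b.2⟩ := Subtype.ext (he a b)
      rw [this, map_mul]
      exact congrArg₂ (· * ·) (hs a) (ht b)


/-- Linearly disjoint finite Galois E₁, E₂ over F; H₁ ≤ Gal(E₁/F), H₂ ≤ Gal(E₂/F)
with fixed fields K₁, K₂.  Then Aut(K₁K₂/F) ≅ Aut(K₁/F) × Aut(K₂/F). -/
theorem stmt_3 (F Ω : Type*) [Field F] [Field Ω] [Algebra F Ω]
    [FiniteDimensional F Ω] [IsGalois F Ω]
    (E1 E2 : IntermediateField F Ω) [IsGalois F E1] [IsGalois F E2]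
    (htop : E1 ⊔ E2 = ⊤) (hdisj : E1 ⊓ E2 = ⊥)
    (H1 : Subgroup (E1 ≃ₐ[F] E1)) (H2 : Subgroup (E2 ≃ₐ[F] E2))
    (K1 : IntermediateField F E1) (hK1 : K1 = IntermediateField.fixedField H1)
    (K2 : IntermediateField F E2) (hK2 : K2 = IntermediateField.fixedField H2)
    (K : IntermediateField F Ω)
    (hK : K = IntermediateField.lift K1 ⊔ IntermediateField.lift K2) :
    Nonempty ((K ≃ₐ[F] K) ≃* (K1 ≃ₐ[F] K1) × (K2 ≃ₐ[F] K2)) := by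
  subst hK
  obtain ⟨g⟩ := aux_main E1 E2 _ _ hdisj (IntermediateField.lift_le K1)
    (IntermediateField.lift_le K2)
  exact ⟨g.symm.trans (MulEquiv.prodCongr
    (AlgEquiv.autCongr (IntermediateField.liftAlgEquiv K1).symm)
    (AlgEquiv.autCongr (IntermediateField.liftAlgEquiv K2).symm))⟩
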